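/- arXiv:2102.10093 — 2 statements merged into one kernel-verified Lean document; each statement's English description precedes it below -/
import Mathlib

section
/- For every n ∈ ℕ, ‖(C1 C2^n C1)ᵀ‖_D^{ℝ³_{≥0}} = 1 and ‖(C2 C1^n C2)ᵀ‖_D^{ℝ³_{≥0}} = 1; that is, sup over nonzero f ∈ ℝ³_{≥0} and nonzero z ∈ f^⊥ of ‖Mᵀ z‖_D / ‖z‖_D equals 1 for M = C1 C2^n C1 and for M = C2 C1^n C2. -/
open Matrix Filter MeasureTheory

noncomputable section

/-- The matrix `C1`. -/
def C1 : Matrix (Fin 3) (Fin 3) ℝ := !![1,1,0; 0,0,1; 0,1,0]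

/-- The matrix `C2`. -/
def C2 : Matrix (Fin 3) (Fin 3) ℝ := !![0,1,0; 1,0,0; 0,1,1]

/-- The seminorm `max(v) - min(v)` on `ℝ³`. -/
def normD (v : Fin 3 → ℝ) : ℝ :=
  max (v 0) (max (v 1) (v 2)) - min (v 0) (min (v 1) (v 2))

/-- The matrix seminorm associated with `normD` and a cone `Λ`:
the sup over nonzero `f ∈ Λ` and nonzero `z ⊥ f` of `normD (M z) / normD z`. -/
def matSemiNormD (M : Matrix (Fin 3) (Fin 3) ℝ) (Λ : Set (Fin 3 → ℝ)) : ℝ :=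
  sSup {r : ℝ | ∃ f ∈ Λ, f ≠ 0 ∧
    ∃ z : Fin 3 → ℝ, z ≠ 0 ∧ (∑ i, z i * f i) = 0 ∧ r = normD (M.mulVec z) / normD z}

/-- The nonnegative orthant of `ℝ³`. -/
def orthant : Set (Fin 3 → ℝ) := {x | ∀ i, 0 ≤ x i}

theorem sub_le_normD (v : Fin 3 → ℝ) (i j : Fin 3) : v i - v j ≤ normD v := by
  unfold normD
  fin_cases i <;> fin_cases j <;> simp <;> grind

theorem normD_le {v : Fin 3 → ℝ} {d : ℝ} (h : ∀ i j, v i - v j ≤ d) : normD v ≤ d := by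
  simp only [Fin.forall_fin_succ] at h
  unfold normD
  simp at h
  grind

theorem normD_eq_of_sub_eq {v w : Fin 3 → ℝ} (σ : Equiv.Perm (Fin 3))
    (h : ∀ i j, v i - v j = w (σ i) - w (σ j)) : normD v = normD w := by
  refine le_antisymm (normD_le fun i j => (h i j).trans_le (sub_le_normD w _ _))
    (normD_le fun i j => ?_)
  simpa [h] using sub_le_normD v (σ.symm i) (σ.symm j)

theorem normD_neg (v : Fin 3 → ℝ) : normD (-v) = normD v := by
  refine le_antisymm (normD_le fun i j => ?_) (normD_le fun i j => ?_)
  · simpa [neg_add_eq_sub] using sub_le_normD v j i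
  · simpa [neg_add_eq_sub] using sub_le_normD (-v) j i

theorem normD_nonneg (v : Fin 3 → ℝ) : 0 ≤ normD v := by
  simpa using sub_le_normD v 0 0

/-- A vector orthogonal to a nonzero nonnegative vector has a nonpositive coordinate. -/
theorem exists_nonpos_of_sum_mul_eq_zero {f z : Fin 3 → ℝ} (hf : f ∈ orthant) (hf0 : f ≠ 0)
    (h : ∑ i, z i * f i = 0) : ∃ i, z i ≤ 0 := by
  by_contra! hz
  obtain ⟨i, hi⟩ := Function.ne_iff.mp hf0
  have hpos : 0 < ∑ i, z i * f i :=
    Finset.sum_pos' (fun j _ => mul_nonneg (hz j).le (hf j))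
      ⟨i, Finset.mem_univ i, mul_pos (hz i) (lt_of_le_of_ne (hf i) (Ne.symm hi))⟩
  exact hpos.ne' h

theorem abs_le_normD {f z : Fin 3 → ℝ} (hf : f ∈ orthant) (hf0 : f ≠ 0)
    (h : ∑ i, z i * f i = 0) (i : Fin 3) : |z i| ≤ normD z := by
  obtain ⟨j, hj⟩ := exists_nonpos_of_sum_mul_eq_zero hf hf0 h
  obtain ⟨k, hk⟩ := exists_nonpos_of_sum_mul_eq_zero (z := -z) hf hf0 (by simpa using h)
  have hk' : 0 ≤ z k := by simpa using hk
  exact abs_le.mpr ⟨by linarith [sub_le_normD z k i], by linarith [sub_le_normD z i j]⟩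

theorem matSemiNormD_eq_one {M : Matrix (Fin 3) (Fin 3) ℝ} {p q : Fin 3} (hpq : p ≠ q)
    (hM : ∀ z, normD (M *ᵥ z) = normD ![0, z p, z q]) : matSemiNormD M orthant = 1 := by
  refine IsGreatest.csSup_eq ⟨?_, ?_⟩
  · refine ⟨Pi.single p 1 + Pi.single q 1, ?_, ?_, Pi.single p 1 - Pi.single q 1, ?_, ?_, ?_⟩
    · intro i
      fin_cases p <;> fin_cases q <;> fin_cases i <;> simp
    · intro h
      simpa [hpq] using congrFun h p
    · intro h
      simpa [hpq] using congrFun h p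
    · fin_cases p <;> fin_cases q <;> simp [Fin.sum_univ_three] at hpq ⊢
    · rw [hM]
      fin_cases p <;> fin_cases q <;> simp [normD] at hpq ⊢
  · rintro _ ⟨f, hf, hf0, z, -, h, rfl⟩
    refine div_le_one_of_le₀ ?_ (normD_nonneg z)
    rw [hM]
    have hp := abs_le.mp (abs_le_normD hf hf0 h p)
    have hq := abs_le.mp (abs_le_normD hf hf0 h q)
    refine normD_le fun i j => ?_
    fin_cases i <;> fin_cases j <;> simp <;>
      linarith [sub_le_normD z p q, sub_le_normD z q p, normD_nonneg z]

theorem C2_pow (n : ℕ) : ∃ k : ℝ, C2 ^ n = !![1,0,0; 0,1,0; k,k,1] ∨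
    C2 ^ n = !![0,1,0; 1,0,0; k,k+1,1] := by
  induction n with
  | zero => exact ⟨0, Or.inl (by rw [pow_zero, one_fin_three])⟩
  | succ n ih =>
    obtain ⟨k, h | h⟩ := ih
    · exact ⟨k, Or.inr (by rw [pow_succ, h, C2]; simp)⟩
    · exact ⟨k + 1, Or.inl (by rw [pow_succ, h, C2]; simp)⟩

theorem C1_pow (n : ℕ) : ∃ k : ℝ, C1 ^ n = !![1,k,k; 0,1,0; 0,0,1] ∨
    C1 ^ n = !![1,k+1,k; 0,0,1; 0,1,0] := by
  induction n with
  | zero => exact ⟨0, Or.inl (by rw [pow_zero, one_fin_three])⟩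
  | succ n ih =>
    obtain ⟨k, h | h⟩ := ih
    · exact ⟨k, Or.inr (by rw [pow_succ, h, C1]; simp [add_comm])⟩
    · exact ⟨k + 1, Or.inl (by rw [pow_succ, h, C1]; simp [add_comm])⟩

theorem semi_norm_eq_one (n : ℕ) :
    matSemiNormD (C1 * C2 ^ n * C1)ᵀ orthant = 1 ∧
    matSemiNormD (C2 * C1 ^ n * C2)ᵀ orthant = 1 := by
  constructor
  · refine matSemiNormD_eq_one (p := 1) (q := 2) (by decide) fun z => ?_
    obtain ⟨k, h | h⟩ := C2_pow n
    · refine normD_eq_of_sub_eq 1 fun i j => ?_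
      rw [h, C1]
      fin_cases i <;> fin_cases j <;>
        simp [mulVec, dotProduct, Fin.sum_univ_three] <;> ring
    · rw [← normD_neg]
      refine normD_eq_of_sub_eq (Equiv.swap 0 1) fun i j => ?_
      rw [h, C1]
      fin_cases i <;> fin_cases j <;>
        simp [mulVec, dotProduct, Fin.sum_univ_three, Equiv.swap_apply_def] <;> ring
  · refine matSemiNormD_eq_one (p := 0) (q := 1) (by decide) fun z => ?_
    obtain ⟨k, h | h⟩ := C1_pow n
    · refine normD_eq_of_sub_eq (finRotate 3) fun i j => ?_
      rw [h, C2]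
      fin_cases i <;> fin_cases j <;>
        simp [mulVec, dotProduct, Fin.sum_univ_three] <;> ring
    · rw [← normD_neg]
      refine normD_eq_of_sub_eq (Equiv.swap 0 1) fun i j => ?_
      rw [h, C2]
      fin_cases i <;> fin_cases j <;>
        simp [mulVec, dotProduct, Fin.sum_univ_three, Equiv.swap_apply_def] <;> ring
end
end

section
/- Let μ be a Borel probability measure on {1,2}^ℕ that is shift-invariant and ergodic. For every ε > 0 and μ-almost every sequence γ = (γ_n) ∈ {1,2}^ℕ, there exists N such that for every n > N, ‖(C_{γ_0}C_{γ_1}⋯C_{γ_{n−1}})ᵀ|_{f^⊥}‖_∞ ≤ (n+3)·(4/5)^{(1/8)·n·(μ([12121212])−ε) − 1/8}, where f ∈ Δ is the unique vector with ⋂_{m≥0} C_{γ_0}⋯C_{γ_{m−1}} ℝ³_{≥0} = ℝ_{≥0} f. -/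
open Matrix Filter MeasureTheory

noncomputable section

/-- The product `M 0 * M 1 * ... * M (n-1)`. -/
def pprod (M : ℕ → Matrix (Fin 3) (Fin 3) ℝ) (n : ℕ) : Matrix (Fin 3) (Fin 3) ℝ :=
  ((List.range n).map M).prod

/-- The image of the nonnegative orthant under `M`. -/
def cone (M : Matrix (Fin 3) (Fin 3) ℝ) : Set (Fin 3 → ℝ) :=
  {y | ∃ x : Fin 3 → ℝ, (∀ i, 0 ≤ x i) ∧ y = M.mulVec x}

/-- The ray generated by `f`. -/
def ray (f : Fin 3 → ℝ) : Set (Fin 3 → ℝ) := {y | ∃ t : ℝ, 0 ≤ t ∧ y = t • f}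

/-- The simplex of nonnegative vectors whose entries sum to 1. -/
def simplex : Set (Fin 3 → ℝ) := {x | (∀ i, 0 ≤ x i) ∧ x 0 + x 1 + x 2 = 1}

/-- The matrix indexed by an element of `{1,2}` (encoded as `Fin 2`). -/
def cMat : Fin 2 → Matrix (Fin 3) (Fin 3) ℝ := ![C1, C2]

/-- The shift map on sequences over `{1,2}` (encoded as `Fin 2`, letter `1` being `0`). -/
def shift : (ℕ → Fin 2) → (ℕ → Fin 2) := fun γ n => γ (n + 1)

/-- The cylinder `[12121212]` of sequences starting with `1,2,1,2,1,2,1,2`. -/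
def cyl8 : Set (ℕ → Fin 2) :=
  {γ | ∀ k < 8, γ k = if k % 2 = 0 then 0 else 1}

/-- The operator norm of `M` restricted to the orthogonal complement of `f`,
with respect to the sup norm on `Fin 3 → ℝ`. -/
def perpNormInf (M : Matrix (Fin 3) (Fin 3) ℝ) (f : Fin 3 → ℝ) : ℝ :=
  sSup {r : ℝ | ∃ z : Fin 3 → ℝ, z ≠ 0 ∧ (∑ i, z i * f i) = 0 ∧ r = ‖M.mulVec z‖ / ‖z‖}

/-- The running maximum `max_{k ≤ N} (g + g ∘ T + ⋯ + g ∘ T^[k-1])` of the Birkhoff sums. -/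
def birkhoffMax {α : Type*} (T : α → α) (g : α → ℝ) : ℕ → α → ℝ
  | 0, _ => 0
  | N + 1, x => max 0 (g x + birkhoffMax T g N (T x))

section BirkhoffMax

variable {α : Type*} {T : α → α} {g : α → ℝ}

theorem birkhoffMax_nonneg (N : ℕ) (x : α) : 0 ≤ birkhoffMax T g N x := by
  cases N with
  | zero => exact le_rfl
  | succ N => exact le_max_left _ _

theorem birkhoffMax_le_succ (N : ℕ) (x : α) :
    birkhoffMax T g N x ≤ birkhoffMax T g (N + 1) x := by
  induction N generalizing x with
  | zero => exact birkhoffMax_nonneg 1 x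
  | succ N ih => exact max_le_max le_rfl (add_le_add le_rfl (ih (T x)))

theorem birkhoffSum_le_birkhoffMax (N : ℕ) (x : α) :
    birkhoffSum T g N x ≤ birkhoffMax T g N x := by
  induction N generalizing x with
  | zero => simp [birkhoffMax]
  | succ N ih =>
    rw [birkhoffSum_succ']
    exact (add_le_add le_rfl (ih (T x))).trans (le_max_right _ _)

theorem bddAbove_birkhoffMax_comp_iff (x : α) :
    BddAbove (Set.range fun N => birkhoffMax T g N (T x)) ↔
      BddAbove (Set.range fun N => birkhoffMax T g N x) := by
  constructor
  · rintro ⟨B, hB⟩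
    refine ⟨max 0 (g x + B), ?_⟩
    rintro _ ⟨N, rfl⟩
    exact (birkhoffMax_le_succ N x).trans
      (max_le_max le_rfl (add_le_add le_rfl (hB ⟨N, rfl⟩)))
  · rintro ⟨B, hB⟩
    refine ⟨B - g x, ?_⟩
    rintro _ ⟨N, rfl⟩
    have h : birkhoffMax T g (N + 1) x ≤ B := hB ⟨N + 1, rfl⟩
    have h' : g x + birkhoffMax T g N (T x) ≤ birkhoffMax T g (N + 1) x := le_max_right _ _
    change birkhoffMax T g N (T x) ≤ B - g x
    linarith

theorem birkhoffMax_succ_sub (N : ℕ) (x : α) :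
    birkhoffMax T g (N + 1) x - birkhoffMax T g N (T x) =
      max (-birkhoffMax T g N (T x)) (g x) := by
  rw [birkhoffMax, ← max_sub_sub_right, zero_sub, add_sub_cancel_right]

variable [MeasurableSpace α] {μ : Measure α}

theorem measurable_birkhoffMax (hT : Measurable T) (hg : Measurable g) (N : ℕ) :
    Measurable (birkhoffMax T g N) := by
  induction N with
  | zero => exact measurable_const
  | succ N ih => exact measurable_const.max (hg.add (ih.comp hT))

theorem integrable_birkhoffMax [IsFiniteMeasure μ] (hT : MeasurePreserving T μ μ)
    (hg : Integrable g μ) (N : ℕ) : Integrable (birkhoffMax T g N) μ := by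
  induction N with
  | zero => exact integrable_const 0
  | succ N ih => exact (integrable_const 0).sup (hg.add (hT.integrable_comp_of_integrable ih))

/-- If an integrable function has negative mean, its Birkhoff sums along an ergodic map are almost
surely bounded above. -/
theorem Ergodic.ae_bddAbove_birkhoffSum [IsProbabilityMeasure μ] (hT : Ergodic T μ)
    (hg : Measurable g) (hgi : Integrable g μ) (hneg : ∫ x, g x ∂μ < 0) :
    ∀ᵐ x ∂μ, BddAbove (Set.range fun n => birkhoffSum T g n x) := by
  have hmp := hT.toMeasurePreserving
  set E : Set α := {x | BddAbove (Set.range fun N => birkhoffMax T g N x)}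
  have hEm : MeasurableSet E :=
    measurableSet_bddAbove_range fun N => measurable_birkhoffMax hmp.measurable hg N
  have hinv : T ⁻¹' E = E := Set.ext fun x => bddAbove_birkhoffMax_comp_iff x
  rcases hT.ae_mem_or_ae_notMem hEm hinv with h | h
  · filter_upwards [h] with x hx
    obtain ⟨B, hB⟩ := hx
    refine ⟨B, ?_⟩
    rintro _ ⟨N, rfl⟩
    exact (birkhoffSum_le_birkhoffMax N x).trans (hB ⟨N, rfl⟩)
  · exfalso
    have hlim : Tendsto
        (fun N => ∫ x, (birkhoffMax T g (N + 1) x - birkhoffMax T g N (T x)) ∂μ)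
        atTop (nhds (∫ x, g x ∂μ)) := by
      refine tendsto_integral_of_dominated_convergence (fun x => |g x|) (fun N => ?_) hgi.abs
        (fun N => ?_) ?_
      · exact ((measurable_birkhoffMax hmp.measurable hg (N + 1)).sub
          ((measurable_birkhoffMax hmp.measurable hg N).comp
            hmp.measurable)).aestronglyMeasurable
      · refine Eventually.of_forall fun x => ?_
        rw [birkhoffMax_succ_sub, Real.norm_eq_abs, abs_le]
        have := birkhoffMax_nonneg (T := T) (g := g) N (T x)
        exact ⟨(neg_abs_le _).trans (le_max_right _ _),
          max_le ((neg_nonpos.2 this).trans (abs_nonneg _)) (le_abs_self _)⟩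
      · filter_upwards [h] with x hx
        have hx' : ¬ BddAbove (Set.range fun N => birkhoffMax T g N (T x)) :=
          fun hb => hx ((bddAbove_birkhoffMax_comp_iff x).1 hb)
        have htop : Tendsto (fun N => birkhoffMax T g N (T x)) atTop atTop :=
          tendsto_atTop_of_monotone (monotone_nat_of_le_succ fun N => birkhoffMax_le_succ N _)
            |>.resolve_right fun ⟨l, hl⟩ => hx' hl.bddAbove_range
        refine tendsto_const_nhds.congr' ?_
        filter_upwards [htop.eventually_ge_atTop (-g x)] with N hN
        rw [birkhoffMax_succ_sub, max_eq_right (by linarith)]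
    have hnonneg : ∀ N : ℕ,
        0 ≤ ∫ x, (birkhoffMax T g (N + 1) x - birkhoffMax T g N (T x)) ∂μ := by
      intro N
      have hi := integrable_birkhoffMax hmp hgi N
      have hi' := integrable_birkhoffMax hmp hgi (N + 1)
      have hcomp : ∫ x, birkhoffMax T g N (T x) ∂μ = ∫ x, birkhoffMax T g N x ∂μ := by
        have := integral_map (μ := μ) hmp.aemeasurable (f := birkhoffMax T g N)
          (measurable_birkhoffMax hmp.measurable hg N).aestronglyMeasurable
        rw [← this, hmp.map_eq]
      have hiT : Integrable (fun x => birkhoffMax T g N (T x)) μ :=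
        hmp.integrable_comp_of_integrable hi
      rw [integral_sub hi' hiT, hcomp, sub_nonneg]
      exact integral_mono hi hi' fun x => birkhoffMax_le_succ N x
    exact absurd (ge_of_tendsto' hlim hnonneg) (not_le.2 hneg)

end BirkhoffMax

theorem measurableSet_cyl8 : MeasurableSet cyl8 := by
  have : cyl8 = ⋂ k : ℕ, ⋂ _ : k < 8,
      (fun γ : ℕ → Fin 2 => γ k) ⁻¹' {if k % 2 = 0 then 0 else 1} := by
    ext γ; simp [cyl8]
  rw [this]
  exact MeasurableSet.iInter fun k => MeasurableSet.iInter fun _ =>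
    measurable_pi_apply k (measurableSet_singleton _)

/-- The number of `k < n` such that `12121212` occurs in `γ` at position `k`. -/
def occ (γ : ℕ → Fin 2) (n : ℕ) : ℝ := birkhoffSum shift (cyl8.indicator 1) n γ

theorem ae_occ_lower_bound (μ : Measure (ℕ → Fin 2)) [IsProbabilityMeasure μ]
    (herg : Ergodic shift μ) {ε : ℝ} (hε : 0 < ε) :
    ∀ᵐ γ ∂μ, ∃ B : ℝ, ∀ n : ℕ, n * ((μ cyl8).toReal - ε) - B ≤ occ γ n := by
  set p : ℝ := (μ cyl8).toReal with hp
  have hci : Integrable (cyl8.indicator (1 : (ℕ → Fin 2) → ℝ)) μ :=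
    (integrable_const (1 : ℝ)).indicator measurableSet_cyl8
  have hint : ∫ γ, ((p - ε) - cyl8.indicator (1 : (ℕ → Fin 2) → ℝ) γ) ∂μ < 0 := by
    rw [integral_sub (integrable_const _) hci, integral_indicator_one measurableSet_cyl8]
    simp [Measure.real, ← hp, hε]
  have := herg.ae_bddAbove_birkhoffSum
    (measurable_const.sub (measurable_one.indicator measurableSet_cyl8))
    ((integrable_const (p - ε)).sub hci) hint
  filter_upwards [this] with γ hγ
  obtain ⟨B, hB⟩ := hγ
  refine ⟨B, fun n => ?_⟩
  have h := hB ⟨n, rfl⟩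
  simp only [birkhoffSum, Pi.sub_apply, Finset.sum_sub_distrib, Finset.sum_const,
    Finset.card_range, nsmul_eq_mul] at h
  simp only [occ, birkhoffSum]
  linarith

/-- A vector that is neither strictly positive nor strictly negative. -/
def Mixed (z : Fin 3 → ℝ) : Prop := (∃ i, z i ≤ 0) ∧ ∃ j, 0 ≤ z j

/-- A norm that does not increase under `C1ᵀ` and `C2ᵀ` along vectors of mixed sign. -/
def hexNorm (z : Fin 3 → ℝ) : ℝ :=
  max (max |z 0 - z 1| |z 1 - z 2|) (max |z 0 - z 2| |z 0 - z 1 + z 2|)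

theorem hexNorm_nonneg (z : Fin 3 → ℝ) : 0 ≤ hexNorm z :=
  (abs_nonneg (z 0 - z 1)).trans ((le_max_left _ _).trans (le_max_left _ _))

theorem hexNorm_le_iff {z : Fin 3 → ℝ} {c : ℝ} :
    hexNorm z ≤ c ↔ ((-c ≤ z 0 - z 1 ∧ z 0 - z 1 ≤ c) ∧ (-c ≤ z 1 - z 2 ∧ z 1 - z 2 ≤ c)) ∧
      (-c ≤ z 0 - z 2 ∧ z 0 - z 2 ≤ c) ∧ (-c ≤ z 0 - z 1 + z 2 ∧ z 0 - z 1 + z 2 ≤ c) := by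
  simp only [hexNorm, max_le_iff, abs_le]

theorem hexNorm_le_three_mul_norm (z : Fin 3 → ℝ) : hexNorm z ≤ 3 * ‖z‖ := by
  have h : ∀ i, -‖z‖ ≤ z i ∧ z i ≤ ‖z‖ := fun i => abs_le.1 (norm_le_pi_norm z i)
  obtain ⟨h0, h0'⟩ := h 0
  obtain ⟨h1, h1'⟩ := h 1
  obtain ⟨h2, h2'⟩ := h 2
  rw [hexNorm_le_iff]
  refine ⟨⟨⟨?_, ?_⟩, ?_, ?_⟩, ⟨?_, ?_⟩, ?_, ?_⟩ <;> linarith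

theorem Mixed.abs_le_hexNorm {z : Fin 3 → ℝ} (hz : Mixed z) (i : Fin 3) : |z i| ≤ hexNorm z := by
  obtain ⟨⟨j, hj⟩, k, hk⟩ := hz
  obtain ⟨⟨⟨h1, h2⟩, h3, h4⟩, ⟨h5, h6⟩, -⟩ := hexNorm_le_iff.1 (le_refl (hexNorm z))
  rw [abs_le]
  fin_cases i <;> fin_cases j <;> fin_cases k <;> simp only [Fin.zero_eta, Fin.mk_one,
    Fin.reduceFinMk] at hj hk ⊢ <;> constructor <;> linarith

theorem Mixed.norm_le_hexNorm {z : Fin 3 → ℝ} (hz : Mixed z) : ‖z‖ ≤ hexNorm z :=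
  (pi_norm_le_iff_of_nonneg (hexNorm_nonneg z)).2 hz.abs_le_hexNorm

theorem C1_transpose_mulVec (z : Fin 3 → ℝ) : C1ᵀ *ᵥ z = ![z 0, z 0 + z 2, z 1] := by
  ext i; fin_cases i <;> simp [C1, mulVec, dotProduct, Fin.sum_univ_three]

theorem C2_transpose_mulVec (z : Fin 3 → ℝ) : C2ᵀ *ᵥ z = ![z 1, z 0 + z 2, z 2] := by
  ext i; fin_cases i <;> simp [C2, mulVec, dotProduct, Fin.sum_univ_three]

theorem Mixed.hexNorm_cMat_le {z : Fin 3 → ℝ} (hz : Mixed z) (i : Fin 2) :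
    hexNorm ((cMat i)ᵀ *ᵥ z) ≤ hexNorm z := by
  obtain ⟨h0, h0'⟩ := abs_le.1 (hz.abs_le_hexNorm 0)
  obtain ⟨h2, h2'⟩ := abs_le.1 (hz.abs_le_hexNorm 2)
  obtain ⟨⟨⟨h3, h4⟩, h5, h6⟩, ⟨h7, h8⟩, h9, h10⟩ := hexNorm_le_iff.1 (le_refl (hexNorm z))
  rw [hexNorm_le_iff]
  fin_cases i <;>
    simp only [cMat, Fin.zero_eta, Fin.mk_one, cons_val_zero, cons_val_one,
      C1_transpose_mulVec, C2_transpose_mulVec, cons_val] <;>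
    refine ⟨⟨⟨?_, ?_⟩, ?_, ?_⟩, ⟨?_, ?_⟩, ?_, ?_⟩ <;> linarith

theorem C2_C1_transpose_mulVec (z : Fin 3 → ℝ) :
    C2ᵀ *ᵥ (C1ᵀ *ᵥ z) = ![z 0 + z 2, z 0 + z 1, z 1] := by
  rw [C1_transpose_mulVec, C2_transpose_mulVec]; rfl

theorem hexNorm_contraction {z y : Fin 3 → ℝ} (hy : Mixed y)
    (h : y = ![4 * z 0 + 3 * z 1 + 2 * z 2, 5 * z 0 + 4 * z 1 + 3 * z 2,
      3 * z 0 + 2 * z 1 + 2 * z 2]) :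
    hexNorm y ≤ 4 / 5 * hexNorm z := by
  obtain ⟨⟨⟨h3, h4⟩, h5, h6⟩, ⟨h7, h8⟩, h9, h10⟩ := hexNorm_le_iff.1 (le_refl (hexNorm z))
  obtain ⟨⟨j, hj⟩, k, hk⟩ := hy
  rw [hexNorm_le_iff]
  subst h
  fin_cases j <;> fin_cases k <;>
    simp only [Fin.zero_eta, Fin.mk_one, Fin.reduceFinMk, cons_val_zero, cons_val_one,
      cons_val] at hj hk ⊢ <;>
    refine ⟨⟨⟨?_, ?_⟩, ?_, ?_⟩, ⟨?_, ?_⟩, ?_, ?_⟩ <;> linarith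

theorem pprod_succ (M : ℕ → Matrix (Fin 3) (Fin 3) ℝ) (n : ℕ) :
    pprod M (n + 1) = pprod M n * M n := by
  simp [pprod, List.range_succ]

theorem pprod_succ_transpose_mulVec (M : ℕ → Matrix (Fin 3) (Fin 3) ℝ) (n : ℕ)
    (z : Fin 3 → ℝ) :
    (pprod M (n + 1))ᵀ *ᵥ z = (M n)ᵀ *ᵥ ((pprod M n)ᵀ *ᵥ z) := by
  rw [pprod_succ, transpose_mul, mulVec_mulVec]

/-- A vector orthogonal to a nonzero element of `cone M` is mapped by `Mᵀ` to a vector of mixed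
sign. -/
theorem mixed_transpose_mulVec {M : Matrix (Fin 3) (Fin 3) ℝ} {f z : Fin 3 → ℝ}
    (hf : f ∈ cone M) (hf0 : f ≠ 0) (hz : ∑ i, z i * f i = 0) : Mixed (Mᵀ *ᵥ z) := by
  obtain ⟨x, hx, rfl⟩ := hf
  have hx0 : ∃ i, 0 < x i := by
    by_contra! h
    exact hf0 (by rw [show x = 0 from funext fun i => le_antisymm (h i) (hx i), mulVec_zero])
  obtain ⟨i, hi⟩ := hx0
  have hzero : ∑ j, (Mᵀ *ᵥ z) j * x j = 0 := by
    change Mᵀ *ᵥ z ⬝ᵥ x = 0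
    rw [mulVec_transpose, ← dotProduct_mulVec]
    exact hz
  constructor
  · by_contra! h
    exact hzero.not_gt (Finset.sum_pos' (fun j _ => mul_nonneg (h j).le (hx j))
      ⟨i, Finset.mem_univ i, mul_pos (h i) hi⟩)
  · by_contra! h
    exact hzero.not_lt (Finset.sum_neg' (fun j _ => mul_nonpos_of_nonpos_of_nonneg (h j).le (hx j))
      ⟨i, Finset.mem_univ i, mul_neg_of_neg_of_pos (h i) hi⟩)

theorem shift_iterate_apply (γ : ℕ → Fin 2) (n k : ℕ) : shift^[n] γ k = γ (n + k) := by
  induction n generalizing γ with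
  | zero => simp
  | succ n ih => rw [Function.iterate_succ_apply, ih, shift]; congr 1; omega

/-- If a nonnegative nonincreasing sequence contracts by `4 / 5` over each occurrence of
`12121212`, it decays geometrically in the number of occurrences. -/
theorem pow_eight_le_of_contracts {γ : ℕ → Fin 2} {V : ℕ → ℝ} (h0 : ∀ n, 0 ≤ V n)
    (hanti : Antitone V) (hc : ∀ n, shift^[n] γ ∈ cyl8 → V (n + 8) ≤ 4 / 5 * V n) (n : ℕ) :
    V (n + 7) ^ 8 ≤ (4 / 5 : ℝ) ^ occ γ n * V 0 ^ 8 := by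
  have hprod : ∏ j ∈ Finset.range 8, V (n + j) ≤
      (4 / 5 : ℝ) ^ occ γ n * ∏ j ∈ Finset.range 8, V (0 + j) := by
    induction n with
    | zero => simp [occ]
    | succ n ih =>
      have hocc : occ γ (n + 1) = occ γ n + cyl8.indicator 1 (shift^[n] γ) :=
        birkhoffSum_succ _ _ _ _
      have hstep : V (n + 8) ≤
          (4 / 5 : ℝ) ^ (cyl8.indicator (1 : (ℕ → Fin 2) → ℝ) (shift^[n] γ)) * V n := by
        by_cases h : shift^[n] γ ∈ cyl8
        · simpa [h] using hc n h
        · simpa [h] using hanti (Nat.le_add_right n 8)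
      have hQ : 0 ≤ ∏ j ∈ Finset.range 7, V (n + (j + 1)) := Finset.prod_nonneg fun _ _ => h0 _
      have hpos : 0 ≤
          (4 / 5 : ℝ) ^ (cyl8.indicator (1 : (ℕ → Fin 2) → ℝ) (shift^[n] γ)) := by positivity
      calc ∏ j ∈ Finset.range 8, V (n + 1 + j)
          = (∏ j ∈ Finset.range 7, V (n + (j + 1))) * V (n + 8) := by
            rw [Finset.prod_range_succ]
            congr 1
        _ ≤ (∏ j ∈ Finset.range 7, V (n + (j + 1))) *
            ((4 / 5 : ℝ) ^ (cyl8.indicator (1 : (ℕ → Fin 2) → ℝ) (shift^[n] γ)) * V n) :=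
            mul_le_mul_of_nonneg_left hstep hQ
        _ = (4 / 5 : ℝ) ^ (cyl8.indicator (1 : (ℕ → Fin 2) → ℝ) (shift^[n] γ)) *
            ∏ j ∈ Finset.range 8, V (n + j) := by
            rw [Finset.prod_range_succ' _ 7, add_zero]; ring
        _ ≤ _ := mul_le_mul_of_nonneg_left ih hpos
        _ = _ := by rw [hocc, Real.rpow_add (by norm_num)]; ring
  calc V (n + 7) ^ 8 = ∏ _j ∈ Finset.range 8, V (n + 7) := by simp
    _ ≤ ∏ j ∈ Finset.range 8, V (n + j) :=
      Finset.prod_le_prod (fun _ _ => h0 _) fun j hj =>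
        hanti (by have := Finset.mem_range.1 hj; omega)
    _ ≤ _ := hprod
    _ ≤ (4 / 5 : ℝ) ^ occ γ n * ∏ _j ∈ Finset.range 8, V 0 :=
      mul_le_mul_of_nonneg_left
        (Finset.prod_le_prod (fun _ _ => h0 _) fun j _ => hanti (Nat.zero_le _)) (by positivity)
    _ = _ := by simp

/-- Over an occurrence of `12121212`, the norm `hexNorm` contracts by `4 / 5`. -/
theorem hexNorm_pprod_add_eight_le {γ : ℕ → Fin 2} {n : ℕ} (hn : shift^[n] γ ∈ cyl8)
    {z : Fin 3 → ℝ} (hz : Mixed ((pprod (fun l => cMat (γ l)) (n + 8))ᵀ *ᵥ z)) :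
    hexNorm ((pprod (fun l => cMat (γ l)) (n + 8))ᵀ *ᵥ z) ≤
      4 / 5 * hexNorm ((pprod (fun l => cMat (γ l)) n)ᵀ *ᵥ z) := by
  refine hexNorm_contraction hz ?_
  have hγ : ∀ k < 8, γ (n + k) = if k % 2 = 0 then 0 else 1 := fun k hk => by
    rw [← shift_iterate_apply γ n k]; exact hn k hk
  have hC1 : ∀ k < 8, k % 2 = 0 → cMat (γ (n + k)) = C1 := fun k hk h => by
    rw [hγ k hk, if_pos h]; rfl
  have hC2 : ∀ k < 8, k % 2 = 1 → cMat (γ (n + k)) = C2 := fun k hk h => by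
    rw [hγ k hk, if_neg (by omega)]; rfl
  have hpair : ∀ k < 7, k % 2 = 0 → (pprod (fun l => cMat (γ l)) (n + (k + 2)))ᵀ *ᵥ z =
      C2ᵀ *ᵥ (C1ᵀ *ᵥ ((pprod (fun l => cMat (γ l)) (n + k))ᵀ *ᵥ z)) := fun k hk h => by
    rw [show n + (k + 2) = n + (k + 1) + 1 by ring, pprod_succ_transpose_mulVec,
      hC2 (k + 1) (by omega) (by omega), ← add_assoc, pprod_succ_transpose_mulVec,
      hC1 k (by omega) h]
  have h2 := hpair 0 (by norm_num) rfl
  have h4 := hpair 2 (by norm_num) rfl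
  have h6 := hpair 4 (by norm_num) rfl
  have h8 := hpair 6 (by norm_num) rfl
  norm_num only [add_zero] at h2 h4 h6 h8
  rw [h8, h6, h4, h2]
  generalize (pprod (fun l => cMat (γ l)) n)ᵀ *ᵥ z = y
  simp only [C2_C1_transpose_mulVec, cons_val]
  ext i
  fin_cases i <;> simp <;> ring

/-- Decay of `(pprod _ n)ᵀ` on `f^⊥` in terms of the number of occurrences of `12121212`. -/
theorem norm_pprod_transpose_mulVec_le {γ : ℕ → Fin 2} {f z : Fin 3 → ℝ} (hf0 : f ≠ 0)
    (hf : ∀ m, f ∈ cone (pprod (fun l => cMat (γ l)) m)) (hz : ∑ i, z i * f i = 0) (n : ℕ) :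
    ‖(pprod (fun l => cMat (γ l)) (n + 7))ᵀ *ᵥ z‖ ≤
      3 * (4 / 5 : ℝ) ^ (1 / 8 * occ γ n) * ‖z‖ := by
  set V : ℕ → ℝ := fun m => hexNorm ((pprod (fun l => cMat (γ l)) m)ᵀ *ᵥ z) with hV
  have hmix : ∀ m, Mixed ((pprod (fun l => cMat (γ l)) m)ᵀ *ᵥ z) := fun m =>
    mixed_transpose_mulVec (hf m) hf0 hz
  have hV0 : V 0 ≤ 3 * ‖z‖ := by
    simpa [hV, pprod] using hexNorm_le_three_mul_norm z
  have hanti : Antitone V := antitone_nat_of_succ_le fun m => by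
    simp only [hV, pprod_succ_transpose_mulVec]
    exact (hmix m).hexNorm_cMat_le (γ m)
  have hpow := pow_eight_le_of_contracts (γ := γ) (fun m => hexNorm_nonneg _) hanti
    (fun m hm => hexNorm_pprod_add_eight_le hm (hmix _)) n
  refine ((hmix (n + 7)).norm_le_hexNorm).trans ?_
  refine le_of_pow_le_pow_left₀ (n := 8) (by norm_num) (by positivity) (hpow.trans ?_)
  have hrpow : ((4 / 5 : ℝ) ^ (1 / 8 * occ γ n)) ^ 8 = (4 / 5 : ℝ) ^ occ γ n := by
    rw [← Real.rpow_natCast, ← Real.rpow_mul (by norm_num)]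
    congr 1
    push_cast
    ring
  calc (4 / 5 : ℝ) ^ occ γ n * V 0 ^ 8 ≤ (4 / 5 : ℝ) ^ occ γ n * (3 * ‖z‖) ^ 8 :=
        mul_le_mul_of_nonneg_left (pow_le_pow_left₀ (hexNorm_nonneg _) hV0 8) (by positivity)
    _ = _ := by rw [← hrpow]; ring

theorem upper_bound_on_perp_norm
    (μ : Measure (ℕ → Fin 2)) [IsProbabilityMeasure μ]
    (herg : Ergodic shift μ) :
    ∀ ε > (0 : ℝ), ∀ᵐ γ ∂μ, ∀ f ∈ simplex,
      (⋂ m : ℕ, cone (pprod (fun l => cMat (γ l)) m)) = ray f →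
      ∃ N : ℕ, ∀ n > N,
        perpNormInf (pprod (fun l => cMat (γ l)) n)ᵀ f ≤
          ((n : ℝ) + 3) *
            (4 / 5 : ℝ) ^ ((1 / 8 : ℝ) * n * ((μ cyl8).toReal - ε) - 1 / 8) := by
  intro ε hε
  filter_upwards [ae_occ_lower_bound μ herg (half_pos hε)] with γ hγ f hf hray
  obtain ⟨B, hB⟩ := hγ
  have hp : (μ cyl8).toReal ≤ 1 := measureReal_le_one
  have hf0 : f ≠ 0 := by
    rintro rfl
    simpa using hf.2
  have hcone : ∀ m, f ∈ cone (pprod (fun l => cMat (γ l)) m) :=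
    Set.mem_iInter.1 (hray ▸ (⟨1, zero_le_one, (one_smul ℝ f).symm⟩ : f ∈ ray f))
  obtain ⟨N, hN⟩ := exists_nat_ge ((B + 7) / (ε / 2))
  refine ⟨N + 7, fun n hn => Real.sSup_le ?_ (by positivity)⟩
  rintro _ ⟨z, hz0, hz, rfl⟩
  obtain ⟨m, rfl⟩ : ∃ m, n = m + 7 := ⟨n - 7, by omega⟩
  rw [div_le_iff₀ (norm_pos_iff.2 hz0)]
  refine (norm_pprod_transpose_mulVec_le hf0 hcone hz m).trans
    (mul_le_mul_of_nonneg_right ?_ (norm_nonneg z))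
  refine mul_le_mul ?_ ?_ (by positivity) (by positivity)
  · push_cast
    linarith [(Nat.cast_nonneg m : (0 : ℝ) ≤ m)]
  · refine Real.rpow_le_rpow_of_exponent_ge (by norm_num) (by norm_num) ?_
    have hm : (B + 7) / (ε / 2) ≤ m := hN.trans (by exact_mod_cast (by omega : N ≤ m))
    rw [div_le_iff₀ (half_pos hε)] at hm
    have := hB m
    push_cast
    nlinarith
end
end
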